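/- arXiv:1611.02635 — 3 statements merged into one kernel-verified Lean document; each statement's English description precedes it below -/
import Mathlib

section
/- Let p ≥ 2 be a real number, σ > 0, let h : ℝ^d → ℝ be differentiable with D_h(x,y) ≥ (σ/p)‖x − y‖^p for all x, y, and let f : ℝ^d → ℝ be convex and differentiable. Let (A_k)_{k≥0} be a strictly increasing sequence of positive reals and set τ_k = (A_{k+1} − A_k)/A_{k+1}. Suppose sequences (x_k), (y_k), (z_k) in ℝ^d satisfy, for all k: x_{k+1} = τ_k z_k + (1 − τ_k) y_k and ∇h(z_{k+1}) = ∇h(z_k) − (A_{k+1} − A_k) ∇f(y_{k+1}). Then, for the minimizer x* of f, the quantity E_k = D_h(x*, z_k) + A_k ( f(y_k) − f(x*) ) satisfies E_{k+1} − E_k ≤ ((p−1)/p) σ^{−1/(p−1)} (A_{k+1} − A_k)^{p/(p−1)} ‖∇f(y_{k+1})‖^{p/(p−1)} + A_{k+1} ⟨∇f(y_{k+1}), y_{k+1} − x_{k+1}⟩ for all k. -/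
open scoped RealInnerProductSpace

/-- Bregman divergence `D_h(y, x) = h(y) - h(x) - ⟪∇h(x), y - x⟫`. -/
noncomputable def breg {E : Type*} [NormedAddCommGroup E] [InnerProductSpace ℝ E]
    [CompleteSpace E] (h : E → ℝ) (y x : E) : ℝ :=
  h y - h x - ⟪gradient h x, y - x⟫

/-- Young's inequality with exponents `p` and `p / (p - 1)` and weight `σ`. -/
theorem mul_le_weighted_young {p σ u v : ℝ} (hp : 1 < p) (hσ : 0 < σ) (hu : 0 ≤ u)
    (hv : 0 ≤ v) :
    u * v ≤ (p - 1) / p * σ ^ (-(1 / (p - 1))) * u ^ (p / (p - 1)) + σ / p * v ^ p := by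
  have hp0 : p ≠ 0 := by linarith
  have hp1 : p - 1 ≠ 0 := by linarith
  have hpq : (p / (p - 1)).HolderConjugate p :=
    (Real.HolderConjugate.conjExponent hp).symm
  have young := Real.young_inequality_of_nonneg
    (mul_nonneg hu (Real.rpow_nonneg hσ.le (-(1 / p))))
    (mul_nonneg hv (Real.rpow_nonneg hσ.le (1 / p))) hpq
  have hcancel : σ ^ (-(1 / p)) * σ ^ (1 / p) = 1 := by
    rw [← Real.rpow_add hσ]; simp
  have hexp : -(1 / p) * (p / (p - 1)) = -(1 / (p - 1)) := by field_simp
  have hexp' : 1 / p * p = 1 := by field_simp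
  rw [Real.mul_rpow hu (Real.rpow_nonneg hσ.le _), Real.mul_rpow hv (Real.rpow_nonneg hσ.le _),
    ← Real.rpow_mul hσ.le, ← Real.rpow_mul hσ.le, hexp, hexp', Real.rpow_one] at young
  calc u * v = u * σ ^ (-(1 / p)) * (v * σ ^ (1 / p)) := by linear_combination -u * v * hcancel
    _ ≤ _ := young
    _ = _ := by field_simp

/-- Three-point identity for a mirror step. -/
theorem breg_sub_breg_of_gradient_eq {E : Type*} [NormedAddCommGroup E] [InnerProductSpace ℝ E]
    [CompleteSpace E] {h : E → ℝ} {z z' v : E} (w : E)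
    (hz : gradient h z' = gradient h z - v) :
    breg h w z' - breg h w z = ⟪v, w - z'⟫ - breg h z' z := by
  simp only [breg, hz, inner_sub_left, inner_sub_right]
  ring

/-- Error bound for the second accelerated gradient family: using the coupling update
`x_{k+1} = τ_k z_k + (1-τ_k) y_k` and the mirror update
`∇h(z_{k+1}) = ∇h(z_k) - (A_{k+1}-A_k) ∇f(y_{k+1})`, the Lyapunov function
`E_k = D_h(x*, z_k) + A_k (f(y_k) - f(x*))` satisfies `E_{k+1} - E_k ≤ ε_{k+1}` with
`ε_{k+1} = ((p-1)/p) σ^{-1/(p-1)} (A_{k+1}-A_k)^{p/(p-1)} ‖∇f(y_{k+1})‖^{p/(p-1)}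
  + A_{k+1} ⟪∇f(y_{k+1}), y_{k+1} - x_{k+1}⟫`. -/
theorem accelerated_family_error_bound_second
    {E : Type*} [NormedAddCommGroup E] [InnerProductSpace ℝ E] [FiniteDimensional ℝ E]
    (p σ : ℝ) (hp : 2 ≤ p) (hσ : 0 < σ)
    (h : E → ℝ) (hh : Differentiable ℝ h)
    (hunif : ∀ x y : E, σ / p * ‖x - y‖ ^ p ≤ breg h x y)
    (f : E → ℝ) (hf : Differentiable ℝ f)
    (hconv : ∀ x y : E, f x + ⟪gradient f x, y - x⟫ ≤ f y)
    (A : ℕ → ℝ) (hApos : ∀ k, 0 < A k) (hAmono : StrictMono A)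
    (x y z : ℕ → E)
    (hcoup : ∀ k, x (k+1) = ((A (k+1) - A k) / A (k+1)) • z k
      + (1 - (A (k+1) - A k) / A (k+1)) • y k)
    (hmir : ∀ k, gradient h (z (k+1))
      = gradient h (z k) - (A (k+1) - A k) • gradient f (y (k+1)))
    (xstar : E) (hmin : ∀ w : E, f xstar ≤ f w) :
    ∀ k : ℕ,
      (breg h xstar (z (k+1)) + A (k+1) * (f (y (k+1)) - f xstar))
          - (breg h xstar (z k) + A k * (f (y k) - f xstar))
        ≤ (p - 1) / p * σ ^ (-(1 / (p - 1))) * (A (k+1) - A k) ^ (p / (p - 1))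
            * ‖gradient f (y (k+1))‖ ^ (p / (p - 1))
          + A (k+1) * ⟪gradient f (y (k+1)), y (k+1) - x (k+1)⟫ := by
  intro k
  have ha : 0 < A (k + 1) - A k := sub_pos.mpr (hAmono k.lt_succ_self)
  have hA := (hApos (k + 1)).ne'
  set a := A (k + 1) - A k with ha_def
  set g := gradient f (y (k + 1)) with hg
  have hx : A (k + 1) • x (k + 1) = a • z k + A k • y k := by
    rw [hcoup k, smul_add, smul_smul, smul_smul]
    congr 2
    · field_simp
      exact ha_def.symm
    · field_simp
      ring
  have hxg : A (k + 1) * ⟪g, x (k + 1)⟫ = a * ⟪g, z k⟫ + A k * ⟪g, y k⟫ := by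
    simpa only [inner_add_right, real_inner_smul_right] using congrArg (fun w => ⟪g, w⟫) hx
  have hbreg := breg_sub_breg_of_gradient_eq xstar (hmir k)
  have hstar := mul_le_mul_of_nonneg_left (hconv (y (k + 1)) xstar) ha.le
  have hy := mul_le_mul_of_nonneg_left (hconv (y (k + 1)) (y k)) (hApos k).le
  have hcs := mul_le_mul_of_nonneg_left (real_inner_le_norm g (z k - z (k + 1))) ha.le
  have young := mul_le_weighted_young (p := p) (by linarith) hσ
    (mul_nonneg ha.le (norm_nonneg g)) (norm_nonneg (z k - z (k + 1)))
  rw [Real.mul_rpow ha.le (norm_nonneg g), norm_sub_rev (z k)] at young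
  rw [norm_sub_rev (z k)] at hcs
  have hD := hunif (z (k + 1)) (z k)
  rw [← hg] at hbreg hstar hy
  simp only [inner_sub_right, real_inner_smul_left] at hbreg hstar hy hcs ⊢
  have hAa : A (k + 1) = A k + a := by rw [ha_def]; ring
  have hmain : A (k + 1) * (⟪g, y (k + 1)⟫ - ⟪g, x (k + 1)⟫)
      = (A k + a) * ⟪g, y (k + 1)⟫ - (a * ⟪g, z k⟫ + A k * ⟪g, y k⟫) := by
    rw [← hxg, ← hAa]; ring
  rw [hmain, hAa]
  linarith
end

section
/- Let σ, μ > 0, let h : ℝ^d → ℝ be differentiable and σ-strongly convex, and let f : ℝ^d → ℝ be differentiable and μ-uniformly convex with respect to h (D_f(x,y) ≥ μ D_h(x,y) for all x, y), attaining its minimum at x*. Let (A_k)_{k≥0} be a strictly increasing sequence of positive reals and set τ_k = (A_{k+1} − A_k)/A_k. Suppose sequences (x_k), (z_k) satisfy, for all k: x_{k+1} = (τ_k/(1+τ_k)) z_k + (1/(1+τ_k)) x_k and ∇h(z_{k+1}) = ∇h(z_k) + τ_k ( ∇h(x_{k+1}) − ∇h(z_{k+1}) − (1/μ) ∇f(x_{k+1})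 ). Then E_k = A_k ( μ D_h(x*, z_k) + f(x_k) − f(x*) ) satisfies E_{k+1} − E_k ≤ ( A_k τ_k² / (2 μ σ) ) ‖∇f(x_{k+1})‖² for all k. -/
open scoped RealInnerProductSpace

/-- Three-point identity for Bregman divergences. -/
theorem breg_three_point {E : Type*} [NormedAddCommGroup E] [InnerProductSpace ℝ E]
    [CompleteSpace E] (h : E → ℝ) (u v w : E) :
    breg h u w = breg h u v + breg h v w + ⟪gradient h v - gradient h w, u - v⟫ := by
  have hsplit : u - w = (u - v) + (v - w) := by abel
  simp only [breg, hsplit, inner_add_right, inner_sub_left]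
  ring

/-- Young's inequality for the inner product, in the scaling of a strong convexity constant. -/
theorem mul_inner_sub_sq_le {E : Type*} [NormedAddCommGroup E] [InnerProductSpace ℝ E]
    {c : ℝ} (hc : 0 < c) (t : ℝ) (g v : E) :
    t * ⟪g, v⟫ - c / 2 * ‖v‖ ^ 2 ≤ t ^ 2 / (2 * c) * ‖g‖ ^ 2 := by
  have key : 0 ≤ ‖t • g - c • v‖ ^ 2 := sq_nonneg _
  rw [norm_sub_sq_real, norm_smul, norm_smul, inner_smul_left, inner_smul_right,
    mul_pow, mul_pow, Real.norm_eq_abs, Real.norm_eq_abs, sq_abs, sq_abs] at key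
  simp only [conj_trivial] at key
  rw [div_mul_eq_mul_div (t ^ 2), le_div_iff₀ (by positivity)]
  linarith

/-- One step of the quasi-monotone method, normalised by the weight `A_k`. -/
theorem quasi_monotone_step_le {E : Type*} [NormedAddCommGroup E] [InnerProductSpace ℝ E]
    [CompleteSpace E] {σ μ τ : ℝ} (hσ : 0 < σ) (hμ : 0 < μ) (hτ : 0 ≤ τ) {h f : E → ℝ}
    (hstrong : ∀ x y : E, σ / 2 * ‖x - y‖ ^ 2 ≤ breg h x y)
    (hunif : ∀ x y : E, μ * breg h x y ≤ breg f x y) (u : E) {x x' z z' : E}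
    (hcoup : x' - x = τ • (z - x'))
    (hmir : gradient h z' = gradient h z
      + τ • (gradient h x' - gradient h z' - (1 / μ) • gradient f x')) :
    (1 + τ) * (μ * breg h u z' + f x' - f u) - (μ * breg h u z + f x - f u)
      ≤ τ ^ 2 / (2 * (μ * σ)) * ‖gradient f x'‖ ^ 2 := by
  have breg_nonneg (a b : E) : 0 ≤ breg h a b := le_trans (by positivity) (hstrong a b)
  have hz := breg_three_point h u z' z
  rw [sub_eq_of_eq_add' hmir, inner_smul_left, inner_sub_left, inner_smul_left] at hz
  simp only [conj_trivial] at hz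
  have hx := breg_three_point h u z' x'
  rw [← neg_sub (gradient h x'), inner_neg_left] at hx
  have hstar := hunif u x'
  have hconv : 0 ≤ breg f x x' := (mul_nonneg hμ.le (breg_nonneg x x')).trans (hunif x x')
  have hsc := mul_le_mul_of_nonneg_left (hstrong z' z) hμ.le
  have hyoung := mul_inner_sub_sq_le (mul_pos hμ hσ) τ (gradient f x') (z - z')
  rw [norm_sub_rev z z'] at hyoung
  have hdir : f x' - f x ≤ τ * ⟪gradient f x', z - x'⟫ := by
    rw [← inner_smul_right, ← hcoup, ← neg_sub x x', inner_neg_right]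
    unfold breg at hconv
    linarith
  have hinner : ⟪gradient f x', z - z'⟫ = ⟪gradient f x', z - x'⟫
      + ⟪gradient f x', u - z'⟫ - ⟪gradient f x', u - x'⟫ := by
    rw [← inner_add_right, ← inner_sub_right]
    congr 1
    abel
  rw [show breg f u x' = f u - f x' - ⟪gradient f x', u - x'⟫ from rfl] at hstar
  have hdrop := mul_nonneg (mul_nonneg hμ.le hτ) (breg_nonneg z' x')
  have hstarτ := mul_le_mul_of_nonneg_left hstar hτ
  have hdist : (1 + τ) * (μ * breg h u z') - μ * breg h u z
      = -(μ * breg h z' z) - μ * τ * breg h z' x' + τ * (μ * breg h u x')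
        + τ * ⟪gradient f x', u - z'⟫ := by
    rw [hz, hx]
    field_simp
    ring
  rw [hinner] at hyoung
  linarith

/-- Error bound for the quasi-monotone method in the strongly convex setting: with
`E_k = A_k (μ D_h(x*, z_k) + f(x_k) - f(x*))` and `τ_k = (A_{k+1} - A_k)/A_k`,
`E_{k+1} - E_k ≤ (A_k τ_k² / (2μσ)) ‖∇f(x_{k+1})‖²`. -/
theorem quasi_monotone_strongly_convex_error_bound
    {E : Type*} [NormedAddCommGroup E] [InnerProductSpace ℝ E] [FiniteDimensional ℝ E]
    (σ μ : ℝ) (hσ : 0 < σ) (hμ : 0 < μ)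
    (h : E → ℝ) (hh : Differentiable ℝ h)
    (hstrong : ∀ x y : E, σ / 2 * ‖x - y‖ ^ 2 ≤ breg h x y)
    (f : E → ℝ) (hf : Differentiable ℝ f)
    (hunif : ∀ x y : E, μ * breg h x y ≤ breg f x y)
    (xstar : E) (hmin : ∀ w : E, f xstar ≤ f w)
    (A : ℕ → ℝ) (hApos : ∀ k, 0 < A k) (hAmono : StrictMono A)
    (x z : ℕ → E)
    (hcoup : ∀ k, x (k+1)
      = (((A (k+1) - A k) / A k) / (1 + (A (k+1) - A k) / A k)) • z k
        + (1 / (1 + (A (k+1) - A k) / A k)) • x k)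
    (hmir : ∀ k, gradient h (z (k+1))
      = gradient h (z k) + ((A (k+1) - A k) / A k) • (gradient h (x (k+1))
          - gradient h (z (k+1)) - (1 / μ) • gradient f (x (k+1)))) :
    ∀ k : ℕ,
      A (k+1) * (μ * breg h xstar (z (k+1)) + f (x (k+1)) - f xstar)
          - A k * (μ * breg h xstar (z k) + f (x k) - f xstar)
        ≤ (A k * ((A (k+1) - A k) / A k) ^ 2 / (2 * μ * σ))
            * ‖gradient f (x (k+1))‖ ^ 2 := by
  intro k
  have hA := hApos k
  have hτ : 0 < (A (k+1) - A k) / A k := div_pos (sub_pos.2 (hAmono k.lt_succ_self)) hA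
  have hAτ : A (k+1) = A k * (1 + (A (k+1) - A k) / A k) := by field_simp; ring
  have hx := hcoup k
  have hz := hmir k
  generalize (A (k+1) - A k) / A k = τ at hτ hAτ hx hz ⊢
  have hdir : x (k+1) - x k = τ • (z k - x (k+1)) := by
    have h1 : (1 + τ) • x (k+1) = τ • z k + x k := by
      rw [hx, smul_add, smul_smul, smul_smul, mul_div_cancel₀ _ (by positivity),
        mul_div_cancel₀ _ (by positivity), one_smul]
    rw [add_smul, one_smul] at h1
    rw [smul_sub, sub_eq_sub_iff_add_eq_add, h1]
  have hstep := mul_le_mul_of_nonneg_left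
    (quasi_monotone_step_le hσ hμ hτ.le hstrong hunif xstar hdir hz) hA.le
  rw [hAτ]
  calc _ = _ := by ring
    _ ≤ _ := hstep
    _ = _ := by ring
end

section
/- Let σ, ε > 0, let h : ℝ^d → ℝ be differentiable and σ-strongly convex, let φ : ℝ^d → ℝ be convex and differentiable with (1/ε)-Lipschitz gradient, and let ψ : ℝ^d → ℝ be convex. Set f = φ + ψ and let x* be a minimizer of f. Let (A_k)_{k≥0} be a strictly increasing sequence of positive reals satisfying (A_{k+1} − A_k)² ≤ ε σ A_{k+1} for all k, and set α_k = A_{k+1} − A_k, τ_k = α_k/A_{k+1}. Suppose sequences (x_k), (y_k), (z_k) and vectors (g_k) satisfy, for all k: x_{k+1} = τ_k z_k + (1 − τ_k) y_k; g_{k+1} is a subgradient of ψ at z_{k+1} (i.e. ψ(z) ≥ ψ(z_{k+1}) + ⟨g_{k+1}, z − z_{k+1}⟩ for all z); ∇h(z_{k+1}) − ∇h(z_k) = −α_k ( ∇φ(x_{k+1}) + g_{k+1} ); and y_{k+1} = τ_k z_{k+1} + (1 − τ_k) y_k. Then E_k = D_h(x*, z_k) + A_k ( f(y_k) − f(x*)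 ) satisfies E_{k+1} − E_k ≤ ( A_{k+1} τ_k² / (2ε) − σ/2 ) ‖z_{k+1} − z_k‖² ≤ 0 for all k; consequently f(y_k) − f(x*) ≤ ( D_h(x*, z_0) + A_0 ( f(y_0) − f(x*) ) ) / A_k. -/
open scoped RealInnerProductSpace

/-- The three-point identity for Bregman divergences. -/
theorem breg_sub_breg {E : Type*} [NormedAddCommGroup E] [InnerProductSpace ℝ E]
    [CompleteSpace E] (h : E → ℝ) (u v w : E) :
    breg h u w - breg h u v = -breg h w v - ⟪gradient h w - gradient h v, u - w⟫ := by
  simp only [breg, inner_sub_left, inner_sub_right]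
  ring

/-- The estimate for the composite objective `φ + ψ` over one step of the accelerated proximal
gradient method: `p` is the gradient of `φ` at `x`, `g` a subgradient of `ψ` at `z'`, `a` and `b`
are the new and the old weight. -/
theorem accelerated_step_objective_le {E : Type*} [NormedAddCommGroup E] [InnerProductSpace ℝ E]
    {ε a b : ℝ} (hb : 0 < b) (hba : b < a) {φ ψ : E → ℝ} {p g x y z y' z' : E}
    (hconv : ∀ w, φ x + ⟪p, w - x⟫ ≤ φ w)
    (hsmooth : ∀ w, φ w ≤ φ x + ⟪p, w - x⟫ + 1 / (2 * ε) * ‖w - x‖ ^ 2)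
    (hψ : ConvexOn ℝ Set.univ ψ) (hsub : ∀ w, ψ z' + ⟪g, w - z'⟫ ≤ ψ w)
    (hx : x = ((a - b) / a) • z + (1 - (a - b) / a) • y)
    (hy : y' = ((a - b) / a) • z' + (1 - (a - b) / a) • y) (u : E) :
    (a - b) * ⟪p + g, u - z'⟫ + a * (φ y' + ψ y' - (φ u + ψ u))
        - b * (φ y + ψ y - (φ u + ψ u))
      ≤ a * ((a - b) / a) ^ 2 / (2 * ε) * ‖z' - z‖ ^ 2 := by
  have ha : 0 < a := hb.trans hba
  set τ := (a - b) / a with hτ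
  have haτ : a * τ = a - b := by rw [hτ]; field_simp
  have hτ0 : 0 ≤ τ := div_nonneg (sub_nonneg.2 hba.le) ha.le
  have hτ1 : 0 ≤ 1 - τ := by
    rw [sub_nonneg, hτ, div_le_one ha]
    linarith
  have hdiff : y' - x = τ • (z' - z) := by
    rw [hx, hy, smul_sub]
    abel
  have hφy' := hsmooth y'
  rw [hdiff, inner_smul_right, norm_smul, Real.norm_of_nonneg hτ0] at hφy'
  have hψy' : ψ y' ≤ τ * ψ z' + (1 - τ) * ψ y := by
    rw [hy]
    exact hψ.2 (Set.mem_univ _) (Set.mem_univ _) hτ0 hτ1 (by ring)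
  have hpx : ⟪p, x⟫ = τ * ⟪p, z⟫ + (1 - τ) * ⟪p, y⟫ := by
    rw [hx, inner_add_right, inner_smul_right, inner_smul_right]
  have hφ_smooth := mul_le_mul_of_nonneg_left hφy' ha.le
  have hψ_conv := mul_le_mul_of_nonneg_left hψy' ha.le
  have hφu := mul_le_mul_of_nonneg_left (hconv u) (sub_nonneg.2 hba.le)
  have hφy := mul_le_mul_of_nonneg_left (hconv y) hb.le
  have hψu := mul_le_mul_of_nonneg_left (hsub u) (sub_nonneg.2 hba.le)
  have hb' : b = a - a * τ := by linarith
  clear_value τ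
  subst hb'
  simp only [inner_add_left, inner_sub_right, hpx] at *
  have hsq : a * τ ^ 2 / (2 * ε) * ‖z' - z‖ ^ 2
      = a * (1 / (2 * ε) * (τ * ‖z' - z‖) ^ 2) := by ring
  rw [hsq]
  linarith

/-- Convergence of the accelerated proximal gradient (FISTA/Tseng) method for the
composite objective `f = φ + ψ`: with `E_k = D_h(x*, z_k) + A_k (f(y_k) - f(x*))`,
`E_{k+1} - E_k ≤ (A_{k+1} τ_k²/(2ε) - σ/2) ‖z_{k+1} - z_k‖² ≤ 0`, whence
`f(y_k) - f(x*) ≤ (D_h(x*, z_0) + A_0 (f(y_0) - f(x*))) / A_k`. -/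
theorem accelerated_proximal_gradient_convergence
    {E : Type*} [NormedAddCommGroup E] [InnerProductSpace ℝ E] [FiniteDimensional ℝ E]
    (σ ε : ℝ) (hσ : 0 < σ) (hε : 0 < ε)
    (h : E → ℝ) (hh : Differentiable ℝ h)
    (hstrong : ∀ x y : E, σ / 2 * ‖x - y‖ ^ 2 ≤ breg h x y)
    (φ : E → ℝ) (hφdiff : Differentiable ℝ φ)
    (hφconv : ∀ x y : E, φ x + ⟪gradient φ x, y - x⟫ ≤ φ y)
    (hφsmooth : ∀ x y : E,
      φ y ≤ φ x + ⟪gradient φ x, y - x⟫ + 1 / (2 * ε) * ‖y - x‖ ^ 2)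
    (ψ : E → ℝ) (hψconv : ConvexOn ℝ Set.univ ψ)
    (xstar : E) (hmin : ∀ w : E, φ xstar + ψ xstar ≤ φ w + ψ w)
    (A : ℕ → ℝ) (hApos : ∀ k, 0 < A k) (hAmono : StrictMono A)
    (hAcond : ∀ k, (A (k+1) - A k) ^ 2 ≤ ε * σ * A (k+1))
    (x y z : ℕ → E) (g : ℕ → E)
    (hcoup : ∀ k, x (k+1) = ((A (k+1) - A k) / A (k+1)) • z k
      + (1 - (A (k+1) - A k) / A (k+1)) • y k)
    (hsub : ∀ k, ∀ w : E, ψ (z (k+1)) + ⟪g (k+1), w - z (k+1)⟫ ≤ ψ w)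
    (hmir : ∀ k, gradient h (z (k+1)) - gradient h (z k)
      = -((A (k+1) - A k) • (gradient φ (x (k+1)) + g (k+1))))
    (hyup : ∀ k, y (k+1) = ((A (k+1) - A k) / A (k+1)) • z (k+1)
      + (1 - (A (k+1) - A k) / A (k+1)) • y k) :
    (∀ k : ℕ,
      (breg h xstar (z (k+1)) + A (k+1) * ((φ (y (k+1)) + ψ (y (k+1))) - (φ xstar + ψ xstar)))
          - (breg h xstar (z k) + A k * ((φ (y k) + ψ (y k)) - (φ xstar + ψ xstar)))
        ≤ (A (k+1) * ((A (k+1) - A k) / A (k+1)) ^ 2 / (2 * ε) - σ / 2)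
            * ‖z (k+1) - z k‖ ^ 2) ∧
    (∀ k : ℕ,
      (A (k+1) * ((A (k+1) - A k) / A (k+1)) ^ 2 / (2 * ε) - σ / 2)
          * ‖z (k+1) - z k‖ ^ 2 ≤ 0) ∧
    (∀ k : ℕ,
      (φ (y k) + ψ (y k)) - (φ xstar + ψ xstar)
        ≤ (breg h xstar (z 0) + A 0 * ((φ (y 0) + ψ (y 0)) - (φ xstar + ψ xstar))) / A k) := by
  have step : ∀ k : ℕ,
      (breg h xstar (z (k+1)) + A (k+1) * ((φ (y (k+1)) + ψ (y (k+1))) - (φ xstar + ψ xstar)))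
          - (breg h xstar (z k) + A k * ((φ (y k) + ψ (y k)) - (φ xstar + ψ xstar)))
        ≤ (A (k+1) * ((A (k+1) - A k) / A (k+1)) ^ 2 / (2 * ε) - σ / 2)
            * ‖z (k+1) - z k‖ ^ 2 := by
    intro k
    have hobj := accelerated_step_objective_le (hApos k) (hAmono k.lt_succ_self)
      (hφconv (x (k+1))) (hφsmooth (x (k+1))) hψconv (hsub k) (hcoup k) (hyup k) xstar
    have hthree := breg_sub_breg h xstar (z k) (z (k+1))
    rw [hmir k, inner_neg_left, real_inner_smul_left] at hthree
    have hlower := hstrong (z (k+1)) (z k)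
    rw [sub_mul]
    linarith
  have nonpos : ∀ k : ℕ,
      (A (k+1) * ((A (k+1) - A k) / A (k+1)) ^ 2 / (2 * ε) - σ / 2)
          * ‖z (k+1) - z k‖ ^ 2 ≤ 0 := by
    intro k
    refine mul_nonpos_of_nonpos_of_nonneg ?_ (sq_nonneg _)
    have ha := hApos (k+1)
    have hcoef : A (k+1) * ((A (k+1) - A k) / A (k+1)) ^ 2 / (2 * ε)
        = (A (k+1) - A k) ^ 2 / (2 * ε * A (k+1)) := by
      field_simp
    rw [hcoef, sub_nonpos, div_le_iff₀ (by positivity)]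
    linarith [hAcond k]
  refine ⟨step, nonpos, fun k => ?_⟩
  have hanti : Antitone fun k => breg h xstar (z k)
      + A k * ((φ (y k) + ψ (y k)) - (φ xstar + ψ xstar)) :=
    antitone_nat_of_succ_le fun k => by linarith [step k, nonpos k]
  have hE := hanti (Nat.zero_le k)
  have hbreg : 0 ≤ breg h xstar (z k) := le_trans (by positivity) (hstrong xstar (z k))
  rw [le_div_iff₀ (hApos k)]
  linarith
end
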